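/- arXiv:1904.00100 — 3 statements merged into one kernel-verified Lean document; each statement's English description precedes it below -/
import Mathlib

section
/- Let Y₁ and Y₂ be independent real-valued random variables on a common probability space, let q ≥ 1, and suppose E|Y₁|^q < ∞, E|Y₂|^q < ∞, Y₂ is integrable and E Y₂ = 0. Then E|Y₁|^q ≤ E|Y₁ + Y₂|^q. -/
open MeasureTheory

theorem convexOn_abs_rpow {q : ℝ} (hq : 1 ≤ q) :
    ConvexOn ℝ Set.univ fun x : ℝ => |x| ^ q := by
  refine ⟨convex_univ, fun x _ y _ a b ha hb hab => ?_⟩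
  calc |a • x + b • y| ^ q ≤ (a • |x| + b • |y|) ^ q := by
        refine Real.rpow_le_rpow (abs_nonneg _) ?_ (zero_le_one.trans hq)
        simpa [abs_mul, abs_of_nonneg ha, abs_of_nonneg hb] using abs_add_le (a * x) (b * y)
    _ ≤ a • |x| ^ q + b • |y| ^ q :=
        (convexOn_rpow hq).2 (abs_nonneg x) (abs_nonneg y) ha hb hab

/-- Adding an independent centered random variable does not decrease the expectation of a
convex function. -/
theorem ConvexOn.integral_comp_le_integral_comp_add_of_indepFun
    {Ω : Type*} [MeasurableSpace Ω] {P : Measure Ω} [IsProbabilityMeasure P]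
    {X Y : Ω → ℝ} {g : ℝ → ℝ} (hg : ConvexOn ℝ Set.univ g) (hgc : Continuous g)
    (hX : Measurable X) (hindep : ProbabilityTheory.IndepFun X Y P)
    (hY : Integrable Y P) (hmean : ∫ ω, Y ω ∂P = 0)
    (hgX : Integrable (fun ω => g (X ω)) P)
    (hgXY : Integrable (fun ω => g (X ω + Y ω)) P) :
    ∫ ω, g (X ω) ∂P ≤ ∫ ω, g (X ω + Y ω) ∂P := by
  have hYm := hY.aemeasurable
  have hXY : AEMeasurable (fun ω => (X ω, Y ω)) P := hX.aemeasurable.prodMk hYm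
  have hmap := (ProbabilityTheory.indepFun_iff_map_prod_eq_prod_map_map
    hX.aemeasurable hYm).1 hindep
  have : IsProbabilityMeasure (P.map X) := Measure.isProbabilityMeasure_map hX.aemeasurable
  have : IsProbabilityMeasure (P.map Y) := Measure.isProbabilityMeasure_map hYm
  have hsum : Continuous fun p : ℝ × ℝ => g (p.1 + p.2) := by fun_prop
  have hprod : Integrable (fun p : ℝ × ℝ => g (p.1 + p.2)) ((P.map X).prod (P.map Y)) := by
    rw [← hmap]
    exact (integrable_map_measure hsum.aestronglyMeasurable hXY).2 hgXY
  have hid : Integrable (fun y : ℝ => y) (P.map Y) :=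
    (integrable_map_measure continuous_id.aestronglyMeasurable hYm).2 hY
  have hid0 : ∫ y, y ∂(P.map Y) = 0 :=
    (integral_map hYm continuous_id.aestronglyMeasurable).trans hmean
  calc ∫ ω, g (X ω) ∂P = ∫ x, g x ∂(P.map X) :=
        (integral_map hX.aemeasurable hgc.aestronglyMeasurable).symm
    _ ≤ ∫ x, ∫ y, g (x + y) ∂(P.map Y) ∂(P.map X) := by
        refine integral_mono_ae
          ((integrable_map_measure hgc.aestronglyMeasurable hX.aemeasurable).2 hgX)
          hprod.integral_prod_left ?_
        filter_upwards [hprod.prod_right_ae] with x hx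
        have hjensen := hg.map_integral_le hgc.continuousOn isClosed_univ
          (Filter.Eventually.of_forall fun _ => Set.mem_univ _)
          ((integrable_const x).add hid) hx
        simpa [integral_add (integrable_const x) hid, hid0] using hjensen
    _ = ∫ p, g (p.1 + p.2) ∂((P.map X).prod (P.map Y)) := (integral_prod _ hprod).symm
    _ = ∫ ω, g (X ω + Y ω) ∂P := by
        rw [← hmap, integral_map hXY hsum.aestronglyMeasurable]

/-- If `Y₁, Y₂` are independent, `q ≥ 1`, `E|Y₁|^q < ∞`, `E|Y₂|^q < ∞`,
`Y₂` is integrable with `E Y₂ = 0`, then `E|Y₁|^q ≤ E|Y₁ + Y₂|^q`. -/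
theorem abs_moment_le_of_indep_add_centered
    {Ω : Type*} [MeasurableSpace Ω] (P : Measure Ω) [IsProbabilityMeasure P]
    (Y₁ Y₂ : Ω → ℝ) (hm₁ : Measurable Y₁) (hm₂ : Measurable Y₂)
    (hindep : ProbabilityTheory.IndepFun Y₁ Y₂ P)
    (q : ℝ) (hq : 1 ≤ q)
    (h1 : Integrable (fun ω => |Y₁ ω| ^ q) P)
    (h2 : Integrable (fun ω => |Y₂ ω| ^ q) P)
    (hint : Integrable Y₂ P) (hmean : ∫ ω, Y₂ ω ∂P = 0) :
    ∫ ω, |Y₁ ω| ^ q ∂P ≤ ∫ ω, |Y₁ ω + Y₂ ω| ^ q ∂P := by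
  have hq0 : 0 < q := zero_lt_one.trans_le hq
  have hmem : ∀ Z : Ω → ℝ, Measurable Z →
      (Integrable (fun ω => |Z ω| ^ q) P ↔ MemLp Z (ENNReal.ofReal q) P) := fun Z hZ => by
    have h := integrable_norm_rpow_iff (μ := P) (p := ENNReal.ofReal q)
      hZ.aestronglyMeasurable (by simpa using hq0) ENNReal.ofReal_ne_top
    rwa [ENNReal.toReal_ofReal hq0.le] at h
  have hsum : Integrable (fun ω => |Y₁ ω + Y₂ ω| ^ q) P :=
    (hmem _ (hm₁.add hm₂)).2 (((hmem _ hm₁).1 h1).add ((hmem _ hm₂).1 h2))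
  exact (convexOn_abs_rpow hq).integral_comp_le_integral_comp_add_of_indepFun
    (continuous_abs.rpow_const fun _ => Or.inr hq0.le) hm₁ hindep hint hmean h1 hsum
end

section
/- Let Y₁ = {Y₁(t), t ≥ 0} and Y₂ = {Y₂(t), t ≥ 0} be real-valued stochastic processes on a common probability space and let 0 < q < 1. Suppose that for every t > 0 the random variables Y₁(t) and Y₂(t) are independent and satisfy 0 < E|Y₁(t)|^q < ∞ and 0 < E|Y₂(t)|^q < ∞; suppose the scaling functions τ_{Y₁}(q) and τ_{Y₂}(q) exist, are finite and positive, and τ_{Y₁}(q) > τ_{Y₂}(q). Then liminf_{t→∞} (log E|Y₁(t) + Y₂(t)|^q)/(log t) ≥ τ_{Y₁}(q). -/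
open MeasureTheory Filter

/-- Subadditivity of `x ↦ |x| ^ q` for `0 ≤ q ≤ 1`. -/
lemma abs_add_rpow_le_add_abs_rpow {q : ℝ} (hq0 : 0 ≤ q) (hq1 : q ≤ 1) (x y : ℝ) :
    |x + y| ^ q ≤ |x| ^ q + |y| ^ q :=
  (Real.rpow_le_rpow (abs_nonneg _) (abs_add_le x y) hq0).trans
    (Real.rpow_add_le_add_rpow (abs_nonneg x) (abs_nonneg y) hq0 hq1)

/-- For `0 ≤ q ≤ 1`, the `q`-th absolute moment of a sum differs from that of the first summand by
at most that of the second. -/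
lemma abs_integral_abs_add_rpow_sub_le {Ω : Type*} [MeasurableSpace Ω] {μ : Measure Ω}
    {X Y : Ω → ℝ} {q : ℝ} (hq0 : 0 ≤ q) (hq1 : q ≤ 1)
    (hmX : Measurable X) (hmY : Measurable Y)
    (hX : Integrable (fun ω => |X ω| ^ q) μ) (hY : Integrable (fun ω => |Y ω| ^ q) μ) :
    |∫ ω, |X ω + Y ω| ^ q ∂μ - ∫ ω, |X ω| ^ q ∂μ| ≤ ∫ ω, |Y ω| ^ q ∂μ := by
  have hS : Integrable (fun ω => |X ω + Y ω| ^ q) μ := by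
    refine (hX.add hY).mono' (by fun_prop) (.of_forall fun ω => ?_)
    rw [Real.norm_of_nonneg (by positivity)]
    exact abs_add_rpow_le_add_abs_rpow hq0 hq1 _ _
  rw [← integral_sub hS hX]
  refine norm_integral_le_of_norm_le (f := fun ω => |X ω + Y ω| ^ q - |X ω| ^ q) hY
    (.of_forall fun ω => ?_)
  have hadd := abs_add_rpow_le_add_abs_rpow hq0 hq1 (X ω) (Y ω)
  have hsub := abs_add_rpow_le_add_abs_rpow hq0 hq1 (X ω + Y ω) (-Y ω)
  rw [add_neg_cancel_right, abs_neg] at hsub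
  rw [Real.norm_eq_abs, abs_le]
  constructor <;> linarith

/-- A perturbation of strictly smaller logarithmic growth rate does not change the logarithmic
growth rate of a positive function. -/
lemma tendsto_log_div_log_of_abs_sub_le {a b s : ℝ → ℝ} {α β : ℝ} (hβα : β < α)
    (ha : ∀ᶠ t in atTop, 0 < a t) (hb : ∀ᶠ t in atTop, 0 < b t)
    (hs : ∀ᶠ t in atTop, |s t - a t| ≤ b t)
    (hα : Tendsto (fun t => Real.log (a t) / Real.log t) atTop (nhds α))
    (hβ : Tendsto (fun t => Real.log (b t) / Real.log t) atTop (nhds β)) :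
    Tendsto (fun t => Real.log (s t) / Real.log t) atTop (nhds α) := by
  have hgap : Tendsto
      (fun t => (Real.log (a t) / Real.log t - Real.log (b t) / Real.log t) * Real.log t)
      atTop atTop :=
    (hα.sub hβ).pos_mul_atTop (sub_pos.2 hβα) Real.tendsto_log_atTop
  have hconst : Tendsto (fun t => Real.log 2 / Real.log t) atTop (nhds 0) :=
    Real.tendsto_log_atTop.const_div_atTop _
  have hbounds : ∀ᶠ t in atTop, 0 < Real.log t ∧
      Real.log (a t) - Real.log 2 ≤ Real.log (s t) ∧
      Real.log (s t) ≤ Real.log (a t) + Real.log 2 := by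
    filter_upwards [ha, hb, hs, hgap.eventually_ge_atTop (Real.log 2), eventually_gt_atTop 1]
      with t hat hbt hst hgt ht
    have hlog : 0 < Real.log t := Real.log_pos ht
    rw [← sub_div, div_mul_cancel₀ _ hlog.ne'] at hgt
    have hba : b t * 2 ≤ a t := by
      rw [← Real.log_le_log_iff (by positivity) hat, Real.log_mul hbt.ne' two_ne_zero]
      linarith
    rw [abs_le] at hst
    have hst0 : 0 < s t := by linarith
    refine ⟨hlog, ?_, ?_⟩
    · rw [← Real.log_div hat.ne' two_ne_zero]
      exact Real.log_le_log (by positivity) (by linarith)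
    · rw [← Real.log_mul hat.ne' two_ne_zero]
      exact Real.log_le_log hst0 (by linarith)
  refine tendsto_of_tendsto_of_tendsto_of_le_of_le' (by simpa using hα.sub hconst)
    (by simpa using hα.add hconst) ?_ ?_
  · filter_upwards [hbounds] with t ⟨hlog, hlower, _⟩
    rw [← sub_div]
    gcongr
  · filter_upwards [hbounds] with t ⟨hlog, _, hupper⟩
    rw [← add_div]
    gcongr

/-- `0 < q < 1`, independent components with existing positive scaling
functions and `τ₁ > τ₂`: `liminf_{t→∞} log E|Y₁(t)+Y₂(t)|^q / log t ≥ τ₁`. -/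
theorem scaling_function_sum_liminf_ge_of_lt_one
    {Ω : Type*} [MeasurableSpace Ω] (P : Measure Ω) [IsProbabilityMeasure P]
    (Y₁ Y₂ : ℝ → Ω → ℝ) (q : ℝ) (hq0 : 0 < q) (hq1 : q < 1)
    (hm₁ : ∀ t : ℝ, 0 < t → Measurable (Y₁ t))
    (hm₂ : ∀ t : ℝ, 0 < t → Measurable (Y₂ t))
    (hindep : ∀ t : ℝ, 0 < t → ProbabilityTheory.IndepFun (Y₁ t) (Y₂ t) P)
    (hi₁ : ∀ t : ℝ, 0 < t → Integrable (fun ω => |Y₁ t ω| ^ q) P)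
    (hi₂ : ∀ t : ℝ, 0 < t → Integrable (fun ω => |Y₂ t ω| ^ q) P)
    (hp₁ : ∀ t : ℝ, 0 < t → 0 < ∫ ω, |Y₁ t ω| ^ q ∂P)
    (hp₂ : ∀ t : ℝ, 0 < t → 0 < ∫ ω, |Y₂ t ω| ^ q ∂P)
    (τ₁ τ₂ : ℝ) (hτ₁pos : 0 < τ₁) (hτ₂pos : 0 < τ₂) (hlt : τ₂ < τ₁)
    (hτ₁ : Tendsto (fun t : ℝ => Real.log (∫ ω, |Y₁ t ω| ^ q ∂P) / Real.log t)
      atTop (nhds τ₁))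
    (hτ₂ : Tendsto (fun t : ℝ => Real.log (∫ ω, |Y₂ t ω| ^ q ∂P) / Real.log t)
      atTop (nhds τ₂)) :
    τ₁ ≤
      liminf (fun t : ℝ => Real.log (∫ ω, |Y₁ t ω + Y₂ t ω| ^ q ∂P) / Real.log t)
        atTop := by
  have hpos : ∀ᶠ t : ℝ in atTop, 0 < t := eventually_gt_atTop 0
  exact (tendsto_log_div_log_of_abs_sub_le hlt (hpos.mono hp₁) (hpos.mono hp₂)
    (hpos.mono fun t ht => abs_integral_abs_add_rpow_sub_le hq0.le hq1.le (hm₁ t ht) (hm₂ t ht)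
      (hi₁ t ht) (hi₂ t ht)) hτ₁ hτ₂).liminf_eq.ge
end

section
/- Let Y₁ = {Y₁(t), t ≥ 0} and Y₂ = {Y₂(t), t ≥ 0} be real-valued stochastic processes on a common probability space such that for every t > 0 the random variables Y₁(t) and Y₂(t) are independent. Let q > 0 and suppose that for every t > 0, 0 < E|Y₁(t)|^q < ∞ and 0 < E|Y₂(t)|^q < ∞, that the scaling functions τ_{Y₁}(q) and τ_{Y₂}(q) exist, are finite and positive, that if q ≥ 1 then Y₁(t) and Y₂(t) are integrable with E Y₁(t) = E Y₂(t) = 0 for every t, and that if q < 1 then τ_{Y₁}(q) ≠ τ_{Y₂}(q). Then the scaling function of the sum process Y₁ + Y₂ = {Y₁(t) + Y₂(t), t ≥ 0} exists at q and equals τ_{Y₁+Y₂}(q) = max{τ_{Y₁}(q), τ_{Y₂}(q)}. -/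
open MeasureTheory Filter

section Pointwise

lemma one_add_mul_le_abs_one_add_rpow {q : ℝ} (hq : 1 ≤ q) (s : ℝ) :
    1 + q * s ≤ |1 + s| ^ q := by
  rcases le_or_gt (-1) s with hs | hs
  · rw [abs_of_nonneg (by linarith)]
    exact one_add_mul_self_le_rpow_one_add hs hq
  · have : 0 ≤ |1 + s| ^ q := by positivity
    nlinarith

lemma abs_rpow_add_mul_le_abs_add_rpow {q : ℝ} (hq : 1 ≤ q) (a b : ℝ) :
    |a| ^ q + q * (|a| ^ q / a * b) ≤ |a + b| ^ q := by
  rcases eq_or_ne a 0 with rfl | ha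
  · have : 0 ≤ |b| ^ q := by positivity
    simpa [Real.zero_rpow (by linarith : q ≠ 0)] using this
  · have h := mul_le_mul_of_nonneg_left (one_add_mul_le_abs_one_add_rpow hq (b / a))
      (by positivity : 0 ≤ |a| ^ q)
    rw [← Real.mul_rpow (abs_nonneg _) (abs_nonneg _), ← abs_mul] at h
    have h₁ : a * (1 + b / a) = a + b := by field_simp
    rw [h₁] at h
    calc |a| ^ q + q * (|a| ^ q / a * b) = |a| ^ q * (1 + q * (b / a)) := by ring
      _ ≤ _ := h

lemma abs_abs_rpow_div_self_le {q : ℝ} (hq : 1 ≤ q) (a : ℝ) :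
    |(|a| ^ q / a)| ≤ 1 + |a| ^ q := by
  rcases eq_or_ne a 0 with rfl | ha
  · simp only [div_zero, abs_zero]; positivity
  have ha' : 0 < |a| := abs_pos.2 ha
  have hnn : 0 ≤ |a| ^ q := by positivity
  rw [abs_div, abs_of_nonneg hnn, div_le_iff₀ ha']
  rcases le_total 1 |a| with h | h
  · nlinarith
  · have : |a| ^ q ≤ |a| ^ (1 : ℝ) := Real.rpow_le_rpow_of_exponent_ge ha' h hq
    rw [Real.rpow_one] at this
    nlinarith

lemma abs_add_rpow_le {q : ℝ} (hq : 0 ≤ q) (a b : ℝ) :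
    |a + b| ^ q ≤ 2 ^ q * (|a| ^ q + |b| ^ q) := by
  have ha : 0 ≤ |a| ^ q := by positivity
  have hb : 0 ≤ |b| ^ q := by positivity
  have h2 : (0 : ℝ) ≤ 2 ^ q := by positivity
  have h : |a + b| ≤ 2 * max |a| |b| := by
    linarith [abs_add_le a b, le_max_left |a| |b|, le_max_right |a| |b|]
  calc |a + b| ^ q ≤ (2 * max |a| |b|) ^ q := Real.rpow_le_rpow (abs_nonneg _) h hq
    _ = 2 ^ q * (max |a| |b|) ^ q := Real.mul_rpow (by norm_num) (by positivity)
    _ ≤ 2 ^ q * (|a| ^ q + |b| ^ q) := by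
      gcongr
      rcases max_choice |a| |b| with h | h <;> rw [h] <;> linarith

end Pointwise

section Moments

variable {Ω : Type*} [MeasurableSpace Ω] {P : Measure Ω} {X Y : Ω → ℝ} {q : ℝ}

lemma integrable_abs_add_rpow (hq : 0 ≤ q) (hX : Measurable X) (hY : Measurable Y)
    (hXq : Integrable (fun ω => |X ω| ^ q) P) (hYq : Integrable (fun ω => |Y ω| ^ q) P) :
    Integrable (fun ω => |X ω + Y ω| ^ q) P := by
  refine ((hXq.add hYq).const_mul (2 ^ q)).mono' (by fun_prop) (ae_of_all _ fun ω => ?_)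
  rw [Real.norm_of_nonneg (by positivity)]
  exact abs_add_rpow_le hq _ _

lemma integral_abs_add_rpow_le (hq : 0 ≤ q) (hX : Measurable X) (hY : Measurable Y)
    (hXq : Integrable (fun ω => |X ω| ^ q) P) (hYq : Integrable (fun ω => |Y ω| ^ q) P) :
    ∫ ω, |X ω + Y ω| ^ q ∂P ≤ 2 ^ q * (∫ ω, |X ω| ^ q ∂P + ∫ ω, |Y ω| ^ q ∂P) := by
  rw [← integral_add hXq hYq, ← integral_const_mul]
  exact integral_mono (integrable_abs_add_rpow hq hX hY hXq hYq)
    ((hXq.add hYq).const_mul (2 ^ q)) fun ω => abs_add_rpow_le hq _ _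

/-- Adding an independent centred variable does not decrease absolute moments of order `q ≥ 1`. -/
lemma integral_abs_rpow_le_integral_abs_add_rpow [IsFiniteMeasure P] (hq : 1 ≤ q)
    (hX : Measurable X) (hY : Measurable Y) (hXY : ProbabilityTheory.IndepFun X Y P)
    (hXq : Integrable (fun ω => |X ω| ^ q) P) (hYq : Integrable (fun ω => |Y ω| ^ q) P)
    (hYi : Integrable Y P) (hY0 : ∫ ω, Y ω ∂P = 0) :
    ∫ ω, |X ω| ^ q ∂P ≤ ∫ ω, |X ω + Y ω| ^ q ∂P := by
  have hgm : Measurable fun x : ℝ => |x| ^ q / x := by fun_prop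
  have hgi : Integrable (fun ω => |X ω| ^ q / X ω) P :=
    ((integrable_const 1).add hXq).mono' (hgm.comp hX).aestronglyMeasurable
      (ae_of_all _ fun ω => abs_abs_rpow_div_self_le hq (X ω))
  have hind : ProbabilityTheory.IndepFun (fun ω => |X ω| ^ q / X ω) Y P :=
    hXY.comp hgm measurable_id
  have hprod : Integrable (fun ω => |X ω| ^ q / X ω * Y ω) P := hind.integrable_mul hgi hYi
  have hzero : ∫ ω, |X ω| ^ q / X ω * Y ω ∂P = 0 := by
    rw [hind.integral_fun_mul_eq_mul_integral hgi.1 hYi.1, hY0, mul_zero]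
  calc ∫ ω, |X ω| ^ q ∂P
      = ∫ ω, (|X ω| ^ q + q * (|X ω| ^ q / X ω * Y ω)) ∂P := by
        rw [integral_add hXq (hprod.const_mul q), integral_const_mul, hzero, mul_zero, add_zero]
    _ ≤ ∫ ω, |X ω + Y ω| ^ q ∂P :=
        integral_mono (hXq.add (hprod.const_mul q))
          (integrable_abs_add_rpow (by linarith) hX hY hXq hYq)
          fun ω => abs_rpow_add_mul_le_abs_add_rpow hq _ _

lemma integral_abs_rpow_le_add (hq : 0 ≤ q) (hX : Measurable X) (hY : Measurable Y)
    (hXq : Integrable (fun ω => |X ω| ^ q) P) (hYq : Integrable (fun ω => |Y ω| ^ q) P) :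
    ∫ ω, |X ω| ^ q ∂P ≤ 2 ^ q * (∫ ω, |X ω + Y ω| ^ q ∂P + ∫ ω, |Y ω| ^ q ∂P) := by
  simpa using integral_abs_add_rpow_le hq (hX.add hY) hY.neg
    (integrable_abs_add_rpow hq hX hY hXq hYq) (by simpa using hYq)

end Moments

section LogScaling

variable {a b s : ℝ → ℝ} {τ₁ τ₂ τ : ℝ}

lemma tendsto_log_max_div_log (ha : ∀ᶠ t in atTop, 0 < a t) (hb : ∀ᶠ t in atTop, 0 < b t)
    (h₁ : Tendsto (fun t => Real.log (a t) / Real.log t) atTop (nhds τ₁))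
    (h₂ : Tendsto (fun t => Real.log (b t) / Real.log t) atTop (nhds τ₂)) :
    Tendsto (fun t => Real.log (max (a t) (b t)) / Real.log t) atTop (nhds (max τ₁ τ₂)) := by
  refine (h₁.max h₂).congr' ?_
  filter_upwards [ha, hb, eventually_gt_atTop 1] with t hat hbt ht
  rw [max_div_div_right (Real.log_pos ht).le]
  congr 1
  rcases le_total (a t) (b t) with h | h
  · rw [max_eq_right h, max_eq_right (Real.log_le_log hat h)]
  · rw [max_eq_left h, max_eq_left (Real.log_le_log hbt h)]

lemma tendsto_log_const_mul_div_log {c : ℝ} (hc : 0 < c) (ha : ∀ᶠ t in atTop, 0 < a t)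
    (h : Tendsto (fun t => Real.log (a t) / Real.log t) atTop (nhds τ)) :
    Tendsto (fun t => Real.log (c * a t) / Real.log t) atTop (nhds τ) := by
  have h₀ : Tendsto (fun t : ℝ => Real.log c / Real.log t) atTop (nhds 0) :=
    Real.tendsto_log_atTop.const_div_atTop _
  rw [← zero_add τ]
  refine (h₀.add h).congr' ?_
  filter_upwards [ha] with t hat
  rw [Real.log_mul hc.ne' hat.ne', add_div]

lemma tendsto_log_div_log_of_le_of_le {c C : ℝ} (hc : 0 < c) (hC : 0 < C)
    (ha : ∀ᶠ t in atTop, 0 < a t)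
    (h : Tendsto (fun t => Real.log (a t) / Real.log t) atTop (nhds τ))
    (hl : ∀ᶠ t in atTop, c * a t ≤ s t) (hu : ∀ᶠ t in atTop, s t ≤ C * a t) :
    Tendsto (fun t => Real.log (s t) / Real.log t) atTop (nhds τ) := by
  refine tendsto_of_tendsto_of_tendsto_of_le_of_le' (tendsto_log_const_mul_div_log hc ha h)
    (tendsto_log_const_mul_div_log hC ha h) ?_ ?_
  · filter_upwards [ha, hl, eventually_gt_atTop 1] with t hat hlt ht
    exact div_le_div_of_nonneg_right (Real.log_le_log (mul_pos hc hat) hlt) (Real.log_pos ht).le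
  · filter_upwards [ha, hl, hu, eventually_gt_atTop 1] with t hat hlt hut ht
    exact div_le_div_of_nonneg_right
      (Real.log_le_log ((mul_pos hc hat).trans_le hlt) hut) (Real.log_pos ht).le

lemma eventually_le_const_mul_of_log_div_log_lt {c : ℝ} (hc : 0 < c)
    (ha : ∀ᶠ t in atTop, 0 < a t) (hb : ∀ᶠ t in atTop, 0 < b t)
    (h₁ : Tendsto (fun t => Real.log (a t) / Real.log t) atTop (nhds τ₁))
    (h₂ : Tendsto (fun t => Real.log (b t) / Real.log t) atTop (nhds τ₂)) (hlt : τ₂ < τ₁) :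
    ∀ᶠ t in atTop, b t ≤ c * a t := by
  filter_upwards [ha, hb, eventually_gt_atTop 1,
    h₂.eventually_lt (tendsto_log_const_mul_div_log hc ha h₁) hlt] with t hat hbt ht h
  rw [div_lt_div_iff_of_pos_right (Real.log_pos ht)] at h
  exact ((Real.log_lt_log_iff hbt (mul_pos hc hat)).1 h).le

/-- If `a` is dominated by a multiple of `s + b` and scales with a larger exponent than `b`, then
`s` is eventually bounded below by a multiple of `max a b`. -/
lemma eventually_const_mul_max_le_of_lt {K : ℝ} (hK : 1 ≤ K)
    (ha : ∀ᶠ t in atTop, 0 < a t) (hb : ∀ᶠ t in atTop, 0 < b t)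
    (h₁ : Tendsto (fun t => Real.log (a t) / Real.log t) atTop (nhds τ₁))
    (h₂ : Tendsto (fun t => Real.log (b t) / Real.log t) atTop (nhds τ₂)) (hlt : τ₂ < τ₁)
    (hs : ∀ᶠ t in atTop, a t ≤ K * (s t + b t)) :
    ∀ᶠ t in atTop, (2 * K)⁻¹ * max (a t) (b t) ≤ s t := by
  have hK0 : 0 < K := by linarith
  filter_upwards [ha, hs, eventually_le_const_mul_of_log_div_log_lt
    (c := (2 * K)⁻¹) (by positivity) ha hb h₁ h₂ hlt] with t hat hst hbt
  have hc : (2 * K)⁻¹ ≤ 1 := inv_le_one_of_one_le₀ (by linarith)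
  rw [max_eq_left (by nlinarith)]
  have hcK : K * ((2 * K)⁻¹ * a t) = a t / 2 := by field_simp
  refine le_of_mul_le_mul_left ?_ hK0
  nlinarith

end LogScaling

/-- Proposition on the scaling function of a sum of independent
processes: under the stated hypotheses, the scaling function of `Y₁ + Y₂` at `q`
exists and equals `max{τ₁, τ₂}`. -/
theorem scaling_function_sum
    {Ω : Type*} [MeasurableSpace Ω] (P : Measure Ω) [IsProbabilityMeasure P]
    (Y₁ Y₂ : ℝ → Ω → ℝ) (q : ℝ) (hq : 0 < q)
    (hm₁ : ∀ t : ℝ, 0 < t → Measurable (Y₁ t))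
    (hm₂ : ∀ t : ℝ, 0 < t → Measurable (Y₂ t))
    (hindep : ∀ t : ℝ, 0 < t → ProbabilityTheory.IndepFun (Y₁ t) (Y₂ t) P)
    (hi₁ : ∀ t : ℝ, 0 < t → Integrable (fun ω => |Y₁ t ω| ^ q) P)
    (hi₂ : ∀ t : ℝ, 0 < t → Integrable (fun ω => |Y₂ t ω| ^ q) P)
    (hp₁ : ∀ t : ℝ, 0 < t → 0 < ∫ ω, |Y₁ t ω| ^ q ∂P)
    (hp₂ : ∀ t : ℝ, 0 < t → 0 < ∫ ω, |Y₂ t ω| ^ q ∂P)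
    (τ₁ τ₂ : ℝ) (hτ₁pos : 0 < τ₁) (hτ₂pos : 0 < τ₂)
    (hτ₁ : Tendsto (fun t : ℝ => Real.log (∫ ω, |Y₁ t ω| ^ q ∂P) / Real.log t)
      atTop (nhds τ₁))
    (hτ₂ : Tendsto (fun t : ℝ => Real.log (∫ ω, |Y₂ t ω| ^ q ∂P) / Real.log t)
      atTop (nhds τ₂))
    (hmean : 1 ≤ q → ∀ t : ℝ, 0 < t →
      Integrable (Y₁ t) P ∧ Integrable (Y₂ t) P ∧
        (∫ ω, Y₁ t ω ∂P = 0) ∧ (∫ ω, Y₂ t ω ∂P = 0))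
    (hne : q < 1 → τ₁ ≠ τ₂) :
    Tendsto (fun t : ℝ => Real.log (∫ ω, |Y₁ t ω + Y₂ t ω| ^ q ∂P) / Real.log t)
      atTop (nhds (max τ₁ τ₂)) := by
  have hA : ∀ᶠ t in atTop, 0 < ∫ ω, |Y₁ t ω| ^ q ∂P := (eventually_gt_atTop 0).mono hp₁
  have hB : ∀ᶠ t in atTop, 0 < ∫ ω, |Y₂ t ω| ^ q ∂P := (eventually_gt_atTop 0).mono hp₂
  have hmax := tendsto_log_max_div_log hA hB hτ₁ hτ₂
  have hmaxpos : ∀ᶠ t in atTop, 0 < max (∫ ω, |Y₁ t ω| ^ q ∂P) (∫ ω, |Y₂ t ω| ^ q ∂P) :=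
    hA.mono fun t ht => lt_max_of_lt_left ht
  have hK : (1 : ℝ) ≤ 2 ^ q := Real.one_le_rpow one_le_two hq.le
  have hupper : ∀ᶠ t in atTop, ∫ ω, |Y₁ t ω + Y₂ t ω| ^ q ∂P ≤
      2 ^ q * 2 * max (∫ ω, |Y₁ t ω| ^ q ∂P) (∫ ω, |Y₂ t ω| ^ q ∂P) := by
    filter_upwards [eventually_gt_atTop 0] with t ht
    refine (integral_abs_add_rpow_le hq.le (hm₁ t ht) (hm₂ t ht) (hi₁ t ht) (hi₂ t ht)).trans ?_
    rw [mul_assoc, two_mul]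
    gcongr
    exacts [le_max_left _ _, le_max_right _ _]
  suffices hlower : ∃ c : ℝ, 0 < c ∧ ∀ᶠ t in atTop,
      c * max (∫ ω, |Y₁ t ω| ^ q ∂P) (∫ ω, |Y₂ t ω| ^ q ∂P) ≤
        ∫ ω, |Y₁ t ω + Y₂ t ω| ^ q ∂P by
    obtain ⟨c, hc, hl⟩ := hlower
    exact tendsto_log_div_log_of_le_of_le hc (by positivity) hmaxpos hmax hl hupper
  rcases le_or_gt 1 q with hq1 | hq1
  · refine ⟨1, one_pos, ?_⟩
    filter_upwards [eventually_gt_atTop 0] with t ht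
    obtain ⟨hY₁, hY₂, hY₁0, hY₂0⟩ := hmean hq1 t ht
    rw [one_mul]
    refine max_le (integral_abs_rpow_le_integral_abs_add_rpow hq1 (hm₁ t ht) (hm₂ t ht)
      (hindep t ht) (hi₁ t ht) (hi₂ t ht) hY₂ hY₂0) ?_
    simpa only [add_comm] using integral_abs_rpow_le_integral_abs_add_rpow hq1 (hm₂ t ht)
      (hm₁ t ht) (hindep t ht).symm (hi₂ t ht) (hi₁ t ht) hY₁ hY₁0
  · refine ⟨(2 * 2 ^ q)⁻¹, by positivity, ?_⟩
    rcases (hne hq1).lt_or_gt with h | h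
    · have hdom : ∀ᶠ t in atTop, ∫ ω, |Y₂ t ω| ^ q ∂P ≤
          2 ^ q * (∫ ω, |Y₁ t ω + Y₂ t ω| ^ q ∂P + ∫ ω, |Y₁ t ω| ^ q ∂P) := by
        filter_upwards [eventually_gt_atTop 0] with t ht
        simpa only [add_comm (Y₂ t _)] using
          integral_abs_rpow_le_add hq.le (hm₂ t ht) (hm₁ t ht) (hi₂ t ht) (hi₁ t ht)
      simpa only [max_comm] using eventually_const_mul_max_le_of_lt hK hB hA hτ₂ hτ₁ h hdom
    · refine eventually_const_mul_max_le_of_lt hK hA hB hτ₁ hτ₂ h ?_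
      filter_upwards [eventually_gt_atTop 0] with t ht
      exact integral_abs_rpow_le_add hq.le (hm₁ t ht) (hm₂ t ht) (hi₁ t ht) (hi₂ t ht)
end
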